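/- Let $\mathbb D$ be the open unit disk in $\mathbb C$. For $0<p<\infty$, let $H^p$ be the space of analytic functions $f$ on $\mathbb D$ with $\|f\|_{H^p}=\sup_{0<r<1}\left(\frac1{2\pi}\int_0^{2\pi}|f(re^{i\theta})|^p\,d\theta\right)^{1/p}<\infty$; for $0<q<\infty$ and $\beta>-1$, let $A^q_\beta$ be the space of analytic functions $f$ on $\mathbb D$ with $\|f\|_{A^q_\beta}=\left((\beta+1)\int_{\mathbb D}|f(z)|^q(1-|z|^2)^\beta\,dA(z)\right)^{1/q}<\infty$, where $dA=\frac1\pi\,dx\,dy$. For $s>0$, a positive Borel measure $\mu$ on $[0,1)$ is called an $s$-Carleson measure if there is a constant $K>0$ with $\mu([t,1))\le K(1-t)^s$ for all $0\le t<1$. Let $0<p<\infty$, $\alpha>1$, $q>1$ with $q\ge\alpha p$, let $q'=q/(q-1)$, and let $\mu$ be a positive Borel measure on $[0,1)$ which is a $(1/p+\alpha/q')$-Carleson measure. Then there exists a constant $C>0$ such that $$\int_{[0,1)}|f(t)|\,|g(t)|\,d\mu(t)\le C\,\|f\|_{H^p}\,\|g\|_{A^{q'}_{\alpha-2}}$$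 for all $f\in H^p$ and all $g\in A^{q'}_{\alpha-2}$. -/

import Mathlib

open MeasureTheory Set

noncomputable section

/-- The set of circle means `M_p(r, f)`, `0 < r < 1`, whose supremum is the Hardy norm. -/
def hardySet (p : ℝ) (f : ℂ → ℂ) : Set ℝ :=
  {y | ∃ r : ℝ, 0 < r ∧ r < 1 ∧
    y = ((2 * Real.pi)⁻¹ *
      ∫ θ in (0:ℝ)..(2 * Real.pi), ‖f ((r : ℂ) * Complex.exp (θ * Complex.I))‖ ^ p) ^ (1 / p)}

/-- The Hardy space norm `‖f‖_{H^p}`. -/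
def hardyNorm (p : ℝ) (f : ℂ → ℂ) : ℝ := sSup (hardySet p f)

/-- Membership in the Hardy space `H^p` of the unit disk. -/
def MemHp (p : ℝ) (f : ℂ → ℂ) : Prop :=
  DifferentiableOn ℂ f (Metric.ball (0:ℂ) 1) ∧ BddAbove (hardySet p f)

/-- The weighted Bergman norm `‖f‖_{A^q_β}` (normalized area measure `dA = (1/π) dx dy`). -/
def bergmanNorm (q β : ℝ) (f : ℂ → ℂ) : ℝ :=
  ((β + 1) * (Real.pi⁻¹ *
    ∫ z in Metric.ball (0:ℂ) 1, ‖f z‖ ^ q * (1 - ‖z‖ ^ 2) ^ β)) ^ (1 / q)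

/-- Membership in the weighted Bergman space `A^q_β`. -/
def MemBergman (q β : ℝ) (f : ℂ → ℂ) : Prop :=
  DifferentiableOn ℂ f (Metric.ball (0:ℂ) 1) ∧
  IntegrableOn (fun z : ℂ => ‖f z‖ ^ q * (1 - ‖z‖ ^ 2) ^ β) (Metric.ball (0:ℂ) 1)

/-- `μ` is an `s`-Carleson measure on `[0,1)`. The inequality is one of extended reals, so it
forces `μ [0,1) < ∞`. -/
def IsCarleson (μ : Measure ℝ) (s : ℝ) : Prop :=
  ∃ C : ℝ, 0 < C ∧ ∀ t : ℝ, 0 ≤ t → t < 1 → μ (Ico t 1) ≤ ENNReal.ofReal (C * (1 - t) ^ s)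

end

open Metric in
theorem continuousOn_poissonKernel_sphere {w : ℂ} (hw : w ∈ ball (0:ℂ) 1) :
    ContinuousOn (fun z => poissonKernel 0 w z) (sphere (0:ℂ) 1) := by
  unfold poissonKernel
  refine ContinuousOn.div (by fun_prop) (by fun_prop) fun z hz => ?_
  have : z ≠ w := by
    rintro rfl
    simp at hz hw
    linarith
  simpa [sub_eq_zero] using this

open Metric in
theorem poissonKernel_nonneg {w z : ℂ} (hw : w ∈ ball (0:ℂ) 1) (hz : z ∈ sphere (0:ℂ) 1) :
    0 ≤ poissonKernel 0 w z := by
  unfold poissonKernel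
  simp only [mem_sphere, dist_zero_right, mem_ball] at hz hw
  refine div_nonneg ?_ (by positivity)
  simp only [sub_zero, hz]
  nlinarith [norm_nonneg w]

open Metric Real Filter Topology in
/-- For a zero-free analytic function, `‖G‖ ^ ε` is at most its Poisson integral. -/
theorem norm_rpow_le_circleAverage_of_ne_zero {G : ℂ → ℂ} {w : ℂ} (ε : ℝ)
    (hG : AnalyticOnNhd ℂ G (closedBall 0 1)) (h0 : ∀ z ∈ closedBall (0:ℂ) 1, G z ≠ 0)
    (hw : w ∈ ball (0:ℂ) 1) :
    ‖G w‖ ^ ε ≤ circleAverage (fun z => poissonKernel 0 w z * ‖G z‖ ^ ε) 0 1 := by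
  have hsub : sphere (0:ℂ) 1 ⊆ closedBall 0 1 := sphere_subset_closedBall
  have hGc : ContinuousOn G (sphere (0:ℂ) 1) := hG.continuousOn.mono hsub
  have hP := continuousOn_poissonKernel_sphere hw
  have hPnn := fun z hz => poissonKernel_nonneg (z := z) hw hz
  have hlog : circleAverage (poissonKernel 0 w • fun z => Real.log ‖G z‖) 0 1 = Real.log ‖G w‖ :=
    InnerProductSpace.HarmonicOnNhd.circleAverage_poissonKernel_smul
      (fun x hx => (hG x hx).harmonicAt_log_norm (h0 x hx)) hw
  have hone : circleAverage (poissonKernel 0 w • fun _ => (1:ℝ)) 0 1 = 1 :=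
    InnerProductSpace.HarmonicOnNhd.circleAverage_poissonKernel_smul
      (fun x hx => InnerProductSpace.harmonicAt_const _) hw
  have hlogc : ContinuousOn (fun z => Real.log ‖G z‖) (sphere (0:ℂ) 1) :=
    hGc.norm.log fun z hz => norm_ne_zero_iff.2 (h0 z (hsub hz))
  have hpow : ContinuousOn (fun z => ‖G z‖ ^ ε) (sphere (0:ℂ) 1) :=
    hGc.norm.rpow_const fun z hz => Or.inl (norm_ne_zero_iff.2 (h0 z (hsub hz)))
  set A := ‖G w‖ ^ ε
  set L := Real.log ‖G w‖
  have hw0 : 0 < ‖G w‖ := norm_pos_iff.2 (h0 w (ball_subset_closedBall hw))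
  have i1 : CircleIntegrable (A • ε • (poissonKernel 0 w • fun z => Real.log ‖G z‖)) 0 1 :=
    (((hP.smul hlogc).const_smul ε).const_smul A).circleIntegrable zero_le_one
  have i2 : CircleIntegrable ((A * (1 - ε * L)) • (poissonKernel 0 w • fun _ => (1:ℝ))) 0 1 :=
    ((hP.smul continuousOn_const).const_smul _).circleIntegrable zero_le_one
  calc A = A * (ε * L) + A * (1 - ε * L) * 1 := by ring
    _ = circleAverage (A • ε • (poissonKernel 0 w • fun z => Real.log ‖G z‖)
        + (A * (1 - ε * L)) • (poissonKernel 0 w • fun _ => (1:ℝ))) 0 1 := by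
      rw [circleAverage_add i1 i2, circleAverage_smul, circleAverage_smul, circleAverage_smul,
        hlog, hone]
      simp
    _ ≤ _ := by
      refine circleAverage_mono (i1.add i2) ((hP.mul hpow).circleIntegrable zero_le_one) ?_
      intro z hz
      rw [abs_one] at hz
      have hz0 : 0 < ‖G z‖ := norm_pos_iff.2 (h0 z (hsub hz))
      have key : A * (ε * Real.log ‖G z‖ + (1 - ε * L)) ≤ ‖G z‖ ^ ε := by
        have e1 : ‖G z‖ ^ ε = A * Real.exp (ε * Real.log ‖G z‖ - ε * L) := by
          simp only [A, L]
          rw [Real.rpow_def_of_pos hz0, Real.rpow_def_of_pos hw0, ← Real.exp_add]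
          congr 1; ring
        rw [e1]
        have := Real.add_one_le_exp (ε * Real.log ‖G z‖ - ε * L)
        have hA : 0 ≤ A := by positivity
        apply mul_le_mul_of_nonneg_left _ hA
        linarith
      have := mul_le_mul_of_nonneg_left key (hPnn z hz)
      simp only [Pi.add_apply, Pi.smul_apply, smul_eq_mul, Pi.mul_apply]
      linarith

open Metric Real Filter Topology in
/-- The inequality between `‖F w‖ ^ ε` and its Poisson integral passes to uniform limits. -/
theorem norm_rpow_le_circleAverage_of_tendstoUniformlyOn {ι : Type*} {l : Filter ι} [l.NeBot]
    [l.IsCountablyGenerated] {F : ι → ℂ → ℂ} {G : ℂ → ℂ} {w : ℂ} {ε : ℝ} (hε : 0 < ε)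
    (hw : w ∈ ball (0:ℂ) 1)
    (hF : ∀ᶠ n in l, ContinuousOn (F n) (closedBall (0:ℂ) 1))
    (hlim : TendstoUniformlyOn F G l (closedBall (0:ℂ) 1))
    (h : ∀ᶠ n in l, ‖F n w‖ ^ ε ≤
      circleAverage (fun z => poissonKernel 0 w z * ‖F n z‖ ^ ε) 0 1) :
    ‖G w‖ ^ ε ≤ circleAverage (fun z => poissonKernel 0 w z * ‖G z‖ ^ ε) 0 1 := by
  have hGc : ContinuousOn G (closedBall (0:ℂ) 1) := hlim.continuousOn hF.frequently
  obtain ⟨B, hB⟩ := (isCompact_closedBall (0:ℂ) 1).exists_bound_of_continuousOn hGc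
  have hP := continuousOn_poissonKernel_sphere hw
  have hcm : ∀ θ : ℝ, circleMap (0:ℂ) 1 θ ∈ sphere (0:ℂ) 1 := fun θ =>
    circleMap_mem_sphere 0 zero_le_one θ
  have hcmc : ∀ θ : ℝ, circleMap (0:ℂ) 1 θ ∈ closedBall (0:ℂ) 1 := fun θ =>
    sphere_subset_closedBall (hcm θ)
  have hPc : Continuous fun θ : ℝ => poissonKernel 0 w (circleMap 0 1 θ) :=
    hP.comp_continuous (continuous_circleMap 0 1) hcm
  have hpt : ∀ z ∈ closedBall (0:ℂ) 1, Tendsto (fun n => ‖F n z‖ ^ ε) l (𝓝 (‖G z‖ ^ ε)) :=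
    fun z hz => ((hlim.tendsto_at hz).norm).rpow_const (Or.inr hε.le)
  refine le_of_tendsto_of_tendsto (hpt w (ball_subset_closedBall hw)) ?_ h
  unfold circleAverage
  refine Tendsto.const_smul ?_ _
  refine intervalIntegral.tendsto_integral_filter_of_dominated_convergence
    (fun θ => |poissonKernel 0 w (circleMap 0 1 θ)| * (B + 1) ^ ε) ?_ ?_ ?_ ?_
  · filter_upwards [hF] with n hn
    refine Continuous.aestronglyMeasurable (hPc.mul ?_)
    exact (hn.comp_continuous (continuous_circleMap 0 1) hcmc).norm.rpow_const
      fun _ => Or.inr hε.le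
  · rw [Metric.tendstoUniformlyOn_iff] at hlim
    filter_upwards [hlim 1 one_pos] with n hn
    refine Eventually.of_forall fun θ _ => ?_
    rw [norm_mul, Real.norm_eq_abs]
    refine mul_le_mul_of_nonneg_left ?_ (abs_nonneg _)
    rw [Real.norm_of_nonneg (by positivity)]
    refine Real.rpow_le_rpow (norm_nonneg _) ?_ hε.le
    have h1 := hn _ (hcmc θ)
    have h2 := hB _ (hcmc θ)
    rw [dist_eq_norm, norm_sub_rev] at h1
    have := norm_le_norm_add_norm_sub' (F n (circleMap 0 1 θ)) (G (circleMap 0 1 θ))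
    linarith
  · exact (hPc.abs.mul continuous_const).intervalIntegrable _ _
  · exact Eventually.of_forall fun θ _ => (hpt _ (hcmc θ)).const_mul _

open Metric ComplexConjugate in
theorem norm_sub_le_norm_one_sub_conj_mul {a z : ℂ} (ha : ‖a‖ ≤ 1) (hz : ‖z‖ ≤ 1) :
    ‖z - a‖ ≤ ‖1 - conj a * z‖ := by
  have h : ‖1 - conj a * z‖ ^ 2 - ‖z - a‖ ^ 2 = (1 - ‖a‖ ^ 2) * (1 - ‖z‖ ^ 2) := by
    simp only [← Complex.normSq_eq_norm_sq, Complex.normSq_apply]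
    simp
    ring
  have h1 : 0 ≤ (1 - ‖a‖ ^ 2) * (1 - ‖z‖ ^ 2) := by
    apply mul_nonneg <;> nlinarith [norm_nonneg a, norm_nonneg z]
  exact (sq_le_sq₀ (norm_nonneg _) (norm_nonneg _)).1 (by linarith)

open Metric ComplexConjugate in
theorem norm_one_sub_conj_mul_eq {a z : ℂ} (hz : ‖z‖ = 1) :
    ‖1 - conj a * z‖ = ‖z - a‖ := by
  have h : ‖1 - conj a * z‖ ^ 2 - ‖z - a‖ ^ 2 = (1 - ‖a‖ ^ 2) * (1 - ‖z‖ ^ 2) := by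
    simp only [← Complex.normSq_eq_norm_sq, Complex.normSq_apply]
    simp
    ring
  rw [hz] at h
  exact (sq_eq_sq₀ (norm_nonneg _) (norm_nonneg _)).1 (by linarith)

open Metric ComplexConjugate in
/-- Reflecting the roots of a polynomial lying in the open disk removes them without changing the
modulus on the unit circle. -/
theorem exists_differentiable_ne_zero_of_multiset (s : Multiset ℂ) :
    ∃ G : ℂ → ℂ, Differentiable ℂ G ∧ (∀ z ∈ ball (0:ℂ) 1, G z ≠ 0) ∧
      (∀ z ∈ ball (0:ℂ) 1, ‖(s.map fun a => z - a).prod‖ ≤ ‖G z‖) ∧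
      ∀ z ∈ sphere (0:ℂ) 1, ‖G z‖ = ‖(s.map fun a => z - a).prod‖ := by
  induction s using Multiset.induction_on with
  | empty => exact ⟨fun _ => 1, by fun_prop, by simp, by simp, by simp⟩
  | cons a s ih =>
    obtain ⟨G, hG, h0, hle, heq⟩ := ih
    by_cases ha : ‖a‖ < 1
    · refine ⟨fun z => (1 - conj a * z) * G z, by fun_prop, fun z hz => ?_, fun z hz => ?_,
        fun z hz => ?_⟩
      · refine mul_ne_zero ?_ (h0 z hz)
        intro h
        have h1 : ‖conj a * z‖ = 1 := by rw [← sub_eq_zero.1 h]; simp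
        rw [norm_mul, RCLike.norm_conj] at h1
        have hz' : ‖z‖ < 1 := by simpa using hz
        nlinarith [norm_nonneg a, norm_nonneg z]
      · simp only [Multiset.map_cons, Multiset.prod_cons, norm_mul]
        have hz' : ‖z‖ < 1 := by simpa using hz
        gcongr
        · exact norm_sub_le_norm_one_sub_conj_mul ha.le hz'.le
        · exact hle z hz
      · simp only [Multiset.map_cons, Multiset.prod_cons, norm_mul]
        rw [heq z hz, norm_one_sub_conj_mul_eq (by simpa using hz)]
    · refine ⟨fun z => (z - a) * G z, by fun_prop, fun z hz => ?_, fun z hz => ?_,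
        fun z hz => ?_⟩
      · refine mul_ne_zero ?_ (h0 z hz)
        rw [sub_ne_zero]
        rintro rfl
        exact ha (by simpa using hz)
      · simp only [Multiset.map_cons, Multiset.prod_cons, norm_mul]
        gcongr
        exact hle z hz
      · simp only [Multiset.map_cons, Multiset.prod_cons, norm_mul]
        rw [heq z hz]

open Metric Real Filter Topology in
theorem norm_rpow_le_circleAverage_of_ne_zero_ball {G : ℂ → ℂ} {w : ℂ} {ε : ℝ} (hε : 0 < ε)
    (hG : Differentiable ℂ G) (h0 : ∀ z ∈ ball (0:ℂ) 1, G z ≠ 0) (hw : w ∈ ball (0:ℂ) 1) :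
    ‖G w‖ ^ ε ≤ circleAverage (fun z => poissonKernel 0 w z * ‖G z‖ ^ ε) 0 1 := by
  refine norm_rpow_le_circleAverage_of_tendstoUniformlyOn (l := 𝓝[<] (1:ℝ))
    (F := fun r z => G (r * z)) hε hw ?_ ?_ ?_
  · exact Eventually.of_forall fun r => (hG.continuous.comp (by fun_prop)).continuousOn
  · have hc : Continuous (fun x : ℝ × ℂ => G (x.1 * x.2)) :=
      hG.continuous.comp (by fun_prop)
    have := UniformContinuousOn.tendstoUniformlyOn (F := fun (r : ℝ) (z : ℂ) => G (r * z))
      (x := (1:ℝ)) (U := Icc 0 2) (V := closedBall (0:ℂ) 1)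
      ((isCompact_Icc.prod (isCompact_closedBall 0 1)).uniformContinuousOn_of_continuous
        hc.continuousOn) (by norm_num)
    have hN : 𝓝[Icc (0:ℝ) 2] 1 = 𝓝 1 := nhdsWithin_eq_nhds.2 (Icc_mem_nhds one_pos one_lt_two)
    rw [hN] at this
    simp only [Complex.ofReal_one, one_mul] at this
    intro u hu
    exact (this u hu).filter_mono nhdsWithin_le_nhds
  · have : Ioo (0:ℝ) 1 ∈ 𝓝[<] (1:ℝ) := Ioo_mem_nhdsLT one_pos
    filter_upwards [this] with r hr
    refine norm_rpow_le_circleAverage_of_ne_zero (G := fun z => G (r * z)) ε ?_ ?_ hw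
    · have : Differentiable ℂ fun z => G (r * z) := by fun_prop
      exact fun z _ => this.analyticAt z
    · intro z hz
      apply h0
      have hz' : ‖z‖ ≤ 1 := by simpa using hz
      simp only [mem_ball, dist_zero_right, norm_mul, Complex.norm_real, Real.norm_eq_abs,
        abs_of_pos hr.1]
      nlinarith [hr.1, hr.2]

open Metric Real Filter Topology in
theorem Polynomial.norm_rpow_le_circleAverage (F : Polynomial ℂ) {w : ℂ} {ε : ℝ}
    (hε : 0 < ε) (hw : w ∈ ball (0:ℂ) 1) :
    ‖F.eval w‖ ^ ε ≤ circleAverage (fun z => poissonKernel 0 w z * ‖F.eval z‖ ^ ε) 0 1 := by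
  by_cases hF : F = 0
  · simp [hF, Real.zero_rpow hε.ne', circleAverage]
  obtain ⟨G, hG, h0, hle, heq⟩ := exists_differentiable_ne_zero_of_multiset F.roots
  have hfac : ∀ z, F.eval z = F.leadingCoeff * (F.roots.map fun a => z - a).prod := by
    intro z
    conv_lhs => rw [(IsAlgClosed.splits F).eq_prod_roots]
    simp [Polynomial.eval_multiset_prod, Multiset.map_map]
  have hlc : F.leadingCoeff ≠ 0 := Polynomial.leadingCoeff_ne_zero.2 hF
  have := norm_rpow_le_circleAverage_of_ne_zero_ball (G := fun z => F.leadingCoeff * G z) hε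
    (by fun_prop) (fun z hz => mul_ne_zero hlc (h0 z hz)) hw
  calc ‖F.eval w‖ ^ ε ≤ ‖F.leadingCoeff * G w‖ ^ ε := by
        rw [hfac, norm_mul, norm_mul]
        gcongr
        exact hle w hw
    _ ≤ _ := this
    _ = _ := by
      refine circleAverage_congr_sphere fun z hz => ?_
      rw [abs_one] at hz
      simp only [hfac, norm_mul, heq z hz]

open Metric Real Filter Topology in
/-- **Subharmonicity of `‖F‖ ^ ε`**: the value at a point of the disk is at most the Poisson
integral of the values on the unit circle. -/
theorem norm_rpow_le_circleAverage {F : ℂ → ℂ} {w : ℂ} {ε ρ : ℝ} (hε : 0 < ε) (hρ : 1 < ρ)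
    (hF : DifferentiableOn ℂ F (ball 0 ρ)) (hw : w ∈ ball (0:ℂ) 1) :
    ‖F w‖ ^ ε ≤ circleAverage (fun z => poissonKernel 0 w z * ‖F z‖ ^ ε) 0 1 := by
  obtain ⟨r, hr1, hrρ⟩ := exists_between hρ
  obtain ⟨r', hr', hr'r⟩ := exists_between hr1
  lift r to NNReal using by linarith
  lift r' to NNReal using by linarith
  obtain ⟨q, hps⟩ : ∃ q, HasFPowerSeriesOnBall F q 0 r :=
    ⟨_, (hF.mono (closedBall_subset_ball hrρ)).hasFPowerSeriesOnBall
      (by exact_mod_cast one_pos.trans hr1)⟩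
  have hu := hps.tendstoUniformlyOn (r' := r') (by exact_mod_cast hr'r)
  have hev : ∀ n (z : ℂ), (∑ k ∈ Finset.range n, Polynomial.C (q.coeff k) * Polynomial.X ^ k).eval z
      = q.partialSum n z := by
    intro n z
    simp only [FormalMultilinearSeries.partialSum, Polynomial.eval_finsetSum, Polynomial.eval_mul,
      Polynomial.eval_C, Polynomial.eval_pow, Polynomial.eval_X,
      FormalMultilinearSeries.apply_eq_pow_smul_coeff, smul_eq_mul]
    exact Finset.sum_congr rfl fun k _ => mul_comm _ _
  refine norm_rpow_le_circleAverage_of_tendstoUniformlyOn (l := atTop)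
    (F := fun n z => q.partialSum n z) hε hw ?_ ?_ ?_
  · refine Eventually.of_forall fun n => ?_
    simp only [← hev]
    exact (Polynomial.continuous _).continuousOn
  · simp only [zero_add] at hu
    exact hu.mono (closedBall_subset_ball (by exact_mod_cast hr'))
  · refine Eventually.of_forall fun n => ?_
    simp only [← hev]
    exact Polynomial.norm_rpow_le_circleAverage _ hε hw

open Metric Real in
theorem ofReal_circleAverage_eq_lintegral {h : ℂ → ℝ} (hc : ContinuousOn h (sphere (0:ℂ) 1))
    (hn : ∀ z ∈ sphere (0:ℂ) 1, 0 ≤ h z) :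
    ENNReal.ofReal (circleAverage h 0 1) =
      ENNReal.ofReal (2 * π)⁻¹ * ∫⁻ θ in Ioc (-π) π, ENNReal.ofReal (h (circleMap 0 1 θ)) := by
  have hcm : ∀ θ : ℝ, circleMap (0:ℂ) 1 θ ∈ sphere (0:ℂ) 1 := fun θ =>
    circleMap_mem_sphere 0 zero_le_one θ
  have hcont : Continuous fun θ => h (circleMap 0 1 θ) :=
    hc.comp_continuous (continuous_circleMap 0 1) hcm
  have hper : Function.Periodic (fun θ => h (circleMap 0 1 θ)) (2 * π) := fun θ => by
    simp only [periodic_circleMap 0 1 θ]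
  have e : ∫ θ in (0:ℝ)..2 * π, h (circleMap 0 1 θ) = ∫ θ in (-π)..π, h (circleMap 0 1 θ) := by
    have := hper.intervalIntegral_add_eq 0 (-π)
    rw [zero_add, show -π + 2 * π = π by ring] at this
    exact this
  rw [circleAverage, e, smul_eq_mul, ENNReal.ofReal_mul (by positivity),
    intervalIntegral.integral_of_le (by linarith [pi_pos]),
    ofReal_integral_eq_lintegral_ofReal]
  · exact (intervalIntegrable_iff_integrableOn_Ioc_of_le (by linarith [pi_pos])).1
      (hcont.intervalIntegrable _ _)
  · exact Filter.Eventually.of_forall fun θ => hn _ (hcm θ)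

open Metric Real in
theorem max_le_pi_mul_norm_circleMap_sub {t θ : ℝ} (ht : 0 ≤ t) (ht1 : t < 1) (hθ : |θ| ≤ π) :
    max (1 - t) |θ| ≤ π * ‖circleMap 0 1 θ - t‖ := by
  have h1 : 1 - t ≤ ‖circleMap 0 1 θ - t‖ := by
    have := norm_sub_norm_le (circleMap 0 1 θ) (t:ℂ)
    simpa [abs_of_nonneg ht] using this
  refine max_le ?_ ?_
  · nlinarith [Real.pi_gt_three, norm_nonneg (circleMap 0 1 θ - t)]
  · have h2 : ‖circleMap 0 1 θ - 1‖ ≤ 2 * ‖circleMap 0 1 θ - t‖ := by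
      have e : circleMap 0 1 θ - 1 = (circleMap 0 1 θ - t) - ((1 - t : ℝ) : ℂ) := by
        push_cast; ring
      rw [e]
      refine (norm_sub_le _ _).trans ?_
      rw [Complex.norm_real, Real.norm_eq_abs, abs_of_pos (by linarith)]
      linarith
    have h3 : 2 * |θ| / π ≤ ‖circleMap 0 1 θ - 1‖ := by
      have e : ‖circleMap 0 1 θ - 1‖ = 2 * |sin (θ / 2)| := by
        have : circleMap 0 1 θ - 1 = Complex.exp (Complex.I * θ) - 1 := by
          simp [circleMap, mul_comm]
        rw [this, Complex.norm_exp_I_mul_ofReal_sub_one]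
        simp
      rw [e]
      have := mul_abs_le_abs_sin (x := θ / 2) (by rw [abs_div, abs_two]; linarith)
      rw [abs_div, abs_two] at this
      calc 2 * |θ| / π = 2 * (2 / π * (|θ| / 2)) := by field_simp
        _ ≤ _ := by linarith
    have hpi := pi_pos
    rw [div_le_iff₀ hpi] at h3
    nlinarith

open Metric Real in
theorem poissonKernel_circleMap_le {t θ : ℝ} (ht : 0 ≤ t) (ht1 : t < 1) (hθ : |θ| ≤ π) :
    poissonKernel 0 t (circleMap 0 1 θ) ≤ 2 * π * (max (1 - t) |θ|)⁻¹ := by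
  have hm : 0 < max (1 - t) |θ| := lt_max_of_lt_left (by linarith)
  have h0 := max_le_pi_mul_norm_circleMap_sub ht ht1 hθ
  have h1 : 1 - t ≤ ‖circleMap 0 1 θ - t‖ := by
    have := norm_sub_norm_le (circleMap 0 1 θ) (t:ℂ)
    simpa [abs_of_nonneg ht] using this
  have hd : 0 < ‖circleMap 0 1 θ - t‖ := by linarith
  calc poissonKernel 0 t (circleMap 0 1 θ) = (1 - t ^ 2) / ‖circleMap 0 1 θ - t‖ ^ 2 := by
        simp [poissonKernel]
    _ ≤ 2 / ‖circleMap 0 1 θ - t‖ := by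
        rw [div_le_div_iff₀ (by positivity) hd]
        have : 1 - t ^ 2 ≤ 2 * ‖circleMap 0 1 θ - t‖ := by nlinarith
        nlinarith
    _ ≤ 2 * π * (max (1 - t) |θ|)⁻¹ := by
        rw [← div_eq_mul_inv, div_le_div_iff₀ hd hm]
        nlinarith

open Metric Real in
/-- Pointwise bound on the radius by the kernel `1 / max (1 - t) |θ|`. -/
theorem ofReal_norm_rpow_le_lintegral {F : ℂ → ℂ} {t ε ρ : ℝ} (hε : 0 < ε) (hρ : 1 < ρ)
    (hF : DifferentiableOn ℂ F (ball 0 ρ)) (ht : 0 ≤ t) (ht1 : t < 1) :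
    ENNReal.ofReal (‖F t‖ ^ ε) ≤ ∫⁻ θ in Ioc (-π) π,
      ENNReal.ofReal (‖F (circleMap 0 1 θ)‖ ^ ε) * ENNReal.ofReal (max (1 - t) |θ|)⁻¹ := by
  have hw : (t:ℂ) ∈ ball (0:ℂ) 1 := by simpa [abs_of_nonneg ht] using ht1
  have hFc : ContinuousOn F (sphere (0:ℂ) 1) :=
    hF.continuousOn.mono ((sphere_subset_closedBall).trans (closedBall_subset_ball hρ))
  have hpow : ContinuousOn (fun z => ‖F z‖ ^ ε) (sphere (0:ℂ) 1) :=
    hFc.norm.rpow_const fun _ _ => Or.inr hε.le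
  refine (ENNReal.ofReal_le_ofReal (norm_rpow_le_circleAverage hε hρ hF hw)).trans ?_
  rw [ofReal_circleAverage_eq_lintegral (h := fun z => poissonKernel 0 t z * ‖F z‖ ^ ε)
    ((continuousOn_poissonKernel_sphere hw).mul hpow)
    fun z hz => mul_nonneg (poissonKernel_nonneg hw hz) (by positivity),
    ← lintegral_const_mul' _ _ ENNReal.ofReal_ne_top]
  refine setLIntegral_mono' measurableSet_Ioc fun θ hθ => ?_
  rw [← ENNReal.ofReal_mul (by positivity), ← ENNReal.ofReal_mul (by positivity)]
  refine ENNReal.ofReal_le_ofReal ?_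
  have := poissonKernel_circleMap_le ht ht1 (abs_le.2 ⟨hθ.1.le, hθ.2⟩)
  calc (2 * π)⁻¹ * (poissonKernel 0 t (circleMap 0 1 θ) * ‖F (circleMap 0 1 θ)‖ ^ ε)
      ≤ (2 * π)⁻¹ * (2 * π * (max (1 - t) |θ|)⁻¹ * ‖F (circleMap 0 1 θ)‖ ^ ε) := by gcongr
    _ = _ := by field_simp

open Metric Real in
/-- Mean value inequality for `‖F‖ ^ ε` on circles. -/
theorem ofReal_norm_rpow_center_le_lintegral {F : ℂ → ℂ} {ε ρ : ℝ} (hε : 0 < ε) (hρ : 1 < ρ)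
    (hF : DifferentiableOn ℂ F (ball 0 ρ)) :
    ENNReal.ofReal (‖F 0‖ ^ ε) ≤ ENNReal.ofReal (2 * π)⁻¹ * ∫⁻ θ in Ioc (-π) π,
      ENNReal.ofReal (‖F (circleMap 0 1 θ)‖ ^ ε) := by
  have hFc : ContinuousOn F (sphere (0:ℂ) 1) :=
    hF.continuousOn.mono ((sphere_subset_closedBall).trans (closedBall_subset_ball hρ))
  have hpow : ContinuousOn (fun z => ‖F z‖ ^ ε) (sphere (0:ℂ) 1) :=
    hFc.norm.rpow_const fun _ _ => Or.inr hε.le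
  rw [← ofReal_circleAverage_eq_lintegral hpow fun z _ => by positivity]
  refine ENNReal.ofReal_le_ofReal ?_
  refine (norm_rpow_le_circleAverage hε hρ hF (mem_ball_self one_pos)).trans_eq ?_
  refine circleAverage_congr_sphere fun z hz => ?_
  rw [abs_one, mem_sphere, dist_zero_right] at hz
  simp [poissonKernel, hz]

open ENNReal in
theorem lintegral_mul_sq_le {X : Type*} [MeasurableSpace X] (ν : Measure X) {f g : X → ℝ≥0∞}
    (hf : AEMeasurable f ν) (hg : AEMeasurable g ν) :
    (∫⁻ x, f x * g x ∂ν) ^ 2 ≤ (∫⁻ x, f x ^ 2 ∂ν) * ∫⁻ x, g x ^ 2 ∂ν := by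
  have h := ENNReal.lintegral_mul_le_Lp_mul_Lq ν Real.HolderConjugate.two_two hf hg
  have h2 := pow_le_pow_left' h 2
  refine h2.trans_eq ?_
  rw [mul_pow, ← ENNReal.rpow_mul_natCast, ← ENNReal.rpow_mul_natCast]
  simp

theorem lintegral_Ioi_inv_max_mul_rpow_le {a : ℝ} (ha : 0 < a) :
    ∫⁻ u in Ioi (0:ℝ), ENNReal.ofReal (max a u)⁻¹ * ENNReal.ofReal (u ^ (-(1/2) : ℝ)) ≤
      ENNReal.ofReal (4 * a ^ (-(1/2) : ℝ)) := by
  have e1 : ∫⁻ u in Ioc (0:ℝ) a, ENNReal.ofReal (max a u)⁻¹ * ENNReal.ofReal (u ^ (-(1/2) : ℝ)) =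
      ENNReal.ofReal (2 * a ^ (-(1/2) : ℝ)) := by
    have hint : IntegrableOn (fun u : ℝ => u ^ (-(1/2) : ℝ)) (Ioc 0 a) :=
      (intervalIntegrable_iff_integrableOn_Ioc_of_le ha.le).1
        (intervalIntegral.intervalIntegrable_rpow' (by norm_num))
    calc _ = ∫⁻ u in Ioc (0:ℝ) a, ENNReal.ofReal a⁻¹ * ENNReal.ofReal (u ^ (-(1/2) : ℝ)) := by
          refine setLIntegral_congr_fun measurableSet_Ioc fun u hu => ?_
          simp only [max_eq_left hu.2]
      _ = ENNReal.ofReal a⁻¹ * ENNReal.ofReal (∫ u in Ioc (0:ℝ) a, u ^ (-(1/2) : ℝ)) := by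
          rw [lintegral_const_mul' _ _ ENNReal.ofReal_ne_top,
            ofReal_integral_eq_lintegral_ofReal hint]
          exact (ae_restrict_mem measurableSet_Ioc).mono fun u hu => Real.rpow_nonneg hu.1.le _
      _ = _ := by
          rw [← intervalIntegral.integral_of_le ha.le, integral_rpow (Or.inl (by norm_num)),
            ← ENNReal.ofReal_mul (by positivity)]
          congr 1
          rw [Real.zero_rpow (by norm_num), ← Real.rpow_neg_one a]
          norm_num
          rw [div_eq_mul_inv, ← mul_assoc, ← Real.rpow_add ha]
          norm_num [mul_comm]
  have e2 : ∫⁻ u in Ioi a, ENNReal.ofReal (max a u)⁻¹ * ENNReal.ofReal (u ^ (-(1/2) : ℝ)) =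
      ENNReal.ofReal (2 * a ^ (-(1/2) : ℝ)) := by
    calc _ = ∫⁻ u in Ioi a, ENNReal.ofReal (u ^ (-(3/2) : ℝ)) := by
          refine setLIntegral_congr_fun measurableSet_Ioi fun u hu => ?_
          have hu' : a < u := hu
          have hu0 : 0 < u := ha.trans hu'
          simp only [max_eq_right hu'.le]
          rw [← ENNReal.ofReal_mul (by positivity), ← Real.rpow_neg_one u, ← Real.rpow_add hu0]
          norm_num
      _ = ENNReal.ofReal (∫ u in Ioi a, u ^ (-(3/2) : ℝ)) := by
          rw [ofReal_integral_eq_lintegral_ofReal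
            (integrableOn_Ioi_rpow_of_lt (by norm_num) ha)]
          exact (ae_restrict_mem measurableSet_Ioi).mono fun u hu =>
            Real.rpow_nonneg (ha.trans hu).le _
      _ = _ := by
          rw [integral_Ioi_rpow_of_lt (by norm_num) ha]
          congr 1
          norm_num
          ring
  rw [← Ioc_union_Ioi_eq_Ioi ha.le]
  refine (lintegral_union_le _ _ _).trans_eq ?_
  rw [e1, e2, ← ENNReal.ofReal_add (by positivity) (by positivity)]
  congr 1; ring

theorem lintegral_abs_le_two_mul (h : ℝ → ENNReal) :
    ∫⁻ θ : ℝ, h |θ| ≤ 2 * ∫⁻ θ in Ioi (0:ℝ), h θ := by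
  have e1 : ∫⁻ θ in Ioi (0:ℝ), h |θ| = ∫⁻ θ in Ioi (0:ℝ), h θ :=
    setLIntegral_congr_fun measurableSet_Ioi fun u hu => by
      simp only [abs_of_pos (show 0 < u from hu)]
  have e2 : ∫⁻ θ in Iic (0:ℝ), h |θ| = ∫⁻ θ in Ioi (0:ℝ), h θ := by
    rw [← e1, setLIntegral_congr (Iio_ae_eq_Iic (a := (0:ℝ))).symm]
    have := (Measure.measurePreserving_neg (volume : Measure ℝ)).setLIntegral_comp_preimage_emb
      (MeasurableEquiv.neg ℝ).measurableEmbedding (fun θ => h |θ|) (Ioi 0)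
    simpa using this
  rw [← setLIntegral_univ, ← Iic_union_Ioi (a := (0:ℝ))]
  refine (lintegral_union_le _ _ _).trans_eq ?_
  rw [e1, e2, two_mul]

open Real in
theorem lintegral_Ioc_inv_max_abs_mul_rpow_le {u : ℝ} (hu : 0 < u) :
    ∫⁻ θ in Ioc (-π) π, ENNReal.ofReal (max u |θ|)⁻¹ * ENNReal.ofReal (|θ| ^ (-(1/2) : ℝ)) ≤
      ENNReal.ofReal (8 * u ^ (-(1/2) : ℝ)) := by
  refine (setLIntegral_le_lintegral _ _).trans ((lintegral_abs_le_two_mul fun θ =>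
    ENNReal.ofReal (max u θ)⁻¹ * ENNReal.ofReal (θ ^ (-(1/2) : ℝ))).trans ?_)
  refine (mul_le_mul_right (lintegral_Ioi_inv_max_mul_rpow_le hu) 2).trans_eq ?_
  rw [show (2:ENNReal) = ENNReal.ofReal 2 by simp, ← ENNReal.ofReal_mul (by norm_num)]
  congr 1; ring

open Real in
/-- The integral operator with kernel `1 / max u |θ|` is bounded on `L²`. -/
theorem lintegral_sq_lintegral_inv_max_le {φ : ℝ → ENNReal} (hφ : Measurable φ) :
    ∫⁻ u in Ioi (0:ℝ), (∫⁻ θ in Ioc (-π) π, φ θ * ENNReal.ofReal (max u |θ|)⁻¹) ^ 2 ≤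
      ENNReal.ofReal 32 * ∫⁻ θ in Ioc (-π) π, φ θ ^ 2 := by
  have hne : ∀ᵐ θ ∂(volume.restrict (Ioc (-π) π)), θ ≠ (0:ℝ) :=
    ae_restrict_of_ae (Measure.ae_ne volume 0)
  have h1 : ∀ u ∈ Ioi (0:ℝ), (∫⁻ θ in Ioc (-π) π, φ θ * ENNReal.ofReal (max u |θ|)⁻¹) ^ 2 ≤
      ∫⁻ θ in Ioc (-π) π, ENNReal.ofReal (8 * u ^ (-(1/2) : ℝ)) *
        (ENNReal.ofReal ((max u |θ|)⁻¹) * ENNReal.ofReal (|θ| ^ (1/2 : ℝ)) * φ θ ^ 2) := by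
    intro u hu
    have hu : 0 < u := hu
    have hm : ∀ θ : ℝ, 0 < max u |θ| := fun θ => lt_max_of_lt_left hu
    have hs : ∀ y : ℝ, 0 ≤ y → (ENNReal.ofReal (√y)) ^ 2 = ENNReal.ofReal y := fun y hy => by
      rw [← ENNReal.ofReal_pow (sqrt_nonneg y), sq_sqrt hy]
    have e : ∫⁻ θ in Ioc (-π) π, φ θ * ENNReal.ofReal (max u |θ|)⁻¹ =
        ∫⁻ θ in Ioc (-π) π, ENNReal.ofReal (√((max u |θ|)⁻¹ * |θ| ^ (-(1/2) : ℝ))) *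
          (ENNReal.ofReal (√((max u |θ|)⁻¹ * |θ| ^ (1/2 : ℝ))) * φ θ) := by
      refine lintegral_congr_ae (hne.mono fun θ hθ => ?_)
      have hθ' : 0 < |θ| := abs_pos.2 hθ
      have hm' := hm θ
      simp only
      rw [← mul_assoc, ← ENNReal.ofReal_mul (sqrt_nonneg _), ← sqrt_mul (by positivity), mul_comm]
      congr 2
      rw [show (max u |θ|)⁻¹ * |θ| ^ (-(1/2) : ℝ) * ((max u |θ|)⁻¹ * |θ| ^ (1/2 : ℝ)) =
        (max u |θ|)⁻¹ ^ 2 * (|θ| ^ (-(1/2) : ℝ) * |θ| ^ (1/2 : ℝ)) by ring, ← rpow_add hθ']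
      norm_num
    rw [e]
    refine (lintegral_mul_sq_le _ (by fun_prop) (by fun_prop)).trans ?_
    rw [lintegral_const_mul' _ _ ENNReal.ofReal_ne_top]
    refine mul_le_mul' ?_ (le_of_eq ?_)
    · refine le_trans (le_of_eq ?_) (lintegral_Ioc_inv_max_abs_mul_rpow_le hu)
      refine lintegral_congr fun θ => ?_
      have hm' := hm θ
      rw [hs _ (by positivity), ENNReal.ofReal_mul (by positivity)]
    · refine lintegral_congr fun θ => ?_
      have hm' := hm θ
      rw [mul_pow, hs _ (by positivity), ENNReal.ofReal_mul (by positivity)]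
  refine (setLIntegral_mono' measurableSet_Ioi h1).trans ?_
  rw [lintegral_lintegral_swap (by fun_prop), ← lintegral_const_mul' _ _ ENNReal.ofReal_ne_top]
  refine lintegral_mono_ae (hne.mono fun θ hθ => ?_)
  have hθ' : 0 < |θ| := abs_pos.2 hθ
  calc _ = ENNReal.ofReal 8 * (ENNReal.ofReal (|θ| ^ (1/2 : ℝ)) * φ θ ^ 2) *
        ∫⁻ u in Ioi (0:ℝ), ENNReal.ofReal (max |θ| u)⁻¹ * ENNReal.ofReal (u ^ (-(1/2) : ℝ)) := by
        rw [← lintegral_const_mul _ (by fun_prop)]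
        refine setLIntegral_congr_fun measurableSet_Ioi fun u hu => ?_
        rw [ENNReal.ofReal_mul (by norm_num), max_comm]
        ring
    _ ≤ ENNReal.ofReal 8 * (ENNReal.ofReal (|θ| ^ (1/2 : ℝ)) * φ θ ^ 2) *
        ENNReal.ofReal (4 * |θ| ^ (-(1/2) : ℝ)) := by
        gcongr
        exact lintegral_Ioi_inv_max_mul_rpow_le hθ'
    _ = ENNReal.ofReal 8 * ENNReal.ofReal (|θ| ^ (1/2 : ℝ)) *
        ENNReal.ofReal (4 * |θ| ^ (-(1/2) : ℝ)) * φ θ ^ 2 := by ring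
    _ = ENNReal.ofReal 32 * φ θ ^ 2 := by
        rw [← ENNReal.ofReal_mul (by norm_num), ← ENNReal.ofReal_mul (by positivity)]
        congr 2
        rw [show 8 * |θ| ^ (1/2 : ℝ) * (4 * |θ| ^ (-(1/2) : ℝ)) =
          32 * (|θ| ^ (1/2 : ℝ) * |θ| ^ (-(1/2) : ℝ)) by ring, ← rpow_add hθ']
        norm_num

/-- The Carleson condition, extended to all scales `u > 0`. -/
theorem IsCarleson.exists_forall_measure_le {μ : Measure ℝ} {s : ℝ} (hs : 0 ≤ s)
    (h : IsCarleson μ s) :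
    ∃ K : ℝ, 0 < K ∧ ∀ u : ℝ, 0 < u →
      μ.restrict (Ico 0 1) {t | 1 - t ≤ u} ≤ ENNReal.ofReal (K * u ^ s) := by
  obtain ⟨K, hK, h⟩ := h
  refine ⟨K, hK, fun u hu => ?_⟩
  have hm : MeasurableSet {t : ℝ | 1 - t ≤ u} := measurableSet_le (by fun_prop) (by fun_prop)
  rw [Measure.restrict_apply hm]
  by_cases hu1 : u ≤ 1
  · refine (measure_mono ?_).trans ((h (1 - u) (by linarith) (by linarith)).trans_eq (by simp))
    rintro t ⟨h1, h2⟩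
    have h1 : 1 - t ≤ u := h1
    exact ⟨by linarith, h2.2⟩
  · refine (measure_mono inter_subset_right).trans ((h 0 le_rfl one_pos).trans ?_)
    refine ENNReal.ofReal_le_ofReal ?_
    have := Real.one_le_rpow (not_le.1 hu1).le hs
    simp only [sub_zero, Real.one_rpow]
    gcongr

theorem IsCarleson.isFiniteMeasure {μ : Measure ℝ} {s : ℝ} (h : IsCarleson μ s) :
    IsFiniteMeasure (μ.restrict (Ico 0 1)) := by
  obtain ⟨K, hK, h⟩ := h
  refine ⟨?_⟩
  rw [Measure.restrict_apply_univ]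
  exact (h 0 le_rfl one_pos).trans_lt ENNReal.ofReal_lt_top

/-- A measure of order `s` at the endpoint, weighted by `(1 - t) ^ (1 - s)`, is dominated by
Lebesgue measure on functions that vary by a bounded factor on dyadic intervals. -/
theorem lintegral_rpow_mul_le_lintegral_Ioi {ν : Measure ℝ} [SFinite ν] {K s : ℝ}
    (hν : ∀ u : ℝ, 0 < u → ν {t | 1 - t ≤ u} ≤ ENNReal.ofReal (K * u ^ s))
    (hs : 0 ≤ s) (hsupp : ∀ᵐ t ∂ν, t < 1) {Ψ : ℝ → ENNReal} (hΨ : Measurable Ψ) {c : ENNReal}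
    (hc : ∀ x u : ℝ, 0 < x → x ≤ u → u ≤ 2 * x → Ψ x ≤ c * Ψ u) :
    ∫⁻ t, ENNReal.ofReal ((1 - t) ^ (1 - s)) * Ψ (1 - t) ∂ν ≤
      ENNReal.ofReal (K * 2 ^ s) * c * ∫⁻ u in Ioi (0:ℝ), Ψ u := by
  have hmS : MeasurableSet {z : ℝ × ℝ | 1 - z.1 ≤ z.2 ∧ z.2 ≤ 2 * (1 - z.1)} := by
    rw [ofPred_and]
    exact (measurableSet_le (by fun_prop) (by fun_prop)).inter
      (measurableSet_le (by fun_prop) (by fun_prop))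
  set S := {z : ℝ × ℝ | 1 - z.1 ≤ z.2 ∧ z.2 ≤ 2 * (1 - z.1)} with hS
  set G : ℝ × ℝ → ENNReal := fun z => ENNReal.ofReal (2 ^ s * z.2 ^ (-s)) * (c * Ψ z.2) with hG
  have h1 : ∀ᵐ t ∂ν, ENNReal.ofReal ((1 - t) ^ (1 - s)) * Ψ (1 - t) ≤
      ∫⁻ u in Ioi (0:ℝ), S.indicator G (t, u) := by
    filter_upwards [hsupp] with t ht
    set x := 1 - t with hx
    have hx0 : 0 < x := by linarith
    calc ENNReal.ofReal (x ^ (1 - s)) * Ψ x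
        = ∫⁻ u in Ioc x (2 * x), ENNReal.ofReal (x ^ (-s)) * Ψ x := by
          rw [setLIntegral_const, Real.volume_Ioc, mul_right_comm,
            ← ENNReal.ofReal_mul (by positivity)]
          congr 2
          rw [show 2 * x - x = x by ring, sub_eq_add_neg, add_comm, Real.rpow_add hx0,
            Real.rpow_one]
      _ ≤ ∫⁻ u in Ioc x (2 * x), ENNReal.ofReal (2 ^ s * u ^ (-s)) * (c * Ψ u) := by
          refine setLIntegral_mono' measurableSet_Ioc fun u hu => ?_
          have hu0 : 0 < u := hx0.trans hu.1
          refine mul_le_mul' (ENNReal.ofReal_le_ofReal ?_) (hc x u hx0 hu.1.le hu.2)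
          have : (2 * x) ^ (-s) ≤ u ^ (-s) :=
            Real.rpow_le_rpow_of_nonpos hu0 hu.2 (by linarith)
          calc x ^ (-s) = 2 ^ s * (2 * x) ^ (-s) := by
                rw [Real.mul_rpow (by norm_num) hx0.le, ← mul_assoc, ← Real.rpow_add two_pos]
                simp
            _ ≤ _ := by gcongr
      _ ≤ _ := by
          rw [← lintegral_indicator measurableSet_Ioc, ← lintegral_indicator measurableSet_Ioi]
          refine lintegral_mono fun u => ?_
          by_cases hu : u ∈ Ioc x (2 * x)
          · rw [indicator_of_mem hu, indicator_of_mem (show u ∈ Ioi 0 from hx0.trans hu.1),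
              indicator_of_mem]
            exact ⟨hu.1.le, hu.2⟩
          · rw [indicator_of_notMem hu]
            exact zero_le
  refine (lintegral_mono_ae h1).trans ?_
  have hGm : Measurable G := by fun_prop
  rw [lintegral_lintegral_swap (f := fun t u => S.indicator G (t, u))
    (hGm.indicator hmS).aemeasurable,
    ← lintegral_const_mul _ hΨ]
  refine setLIntegral_mono' measurableSet_Ioi fun u hu => ?_
  have hu : 0 < u := hu
  calc _ ≤ ∫⁻ t, {t : ℝ | 1 - t ≤ u}.indicator
        (fun _ => ENNReal.ofReal (2 ^ s * u ^ (-s)) * (c * Ψ u)) t ∂ν := by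
        refine lintegral_mono fun t => ?_
        by_cases h : (t, u) ∈ S
        · rw [indicator_of_mem h, indicator_of_mem (show t ∈ {t : ℝ | 1 - t ≤ u} from h.1)]
        · rw [indicator_of_notMem h]
          exact zero_le
    _ = ENNReal.ofReal (2 ^ s * u ^ (-s)) * (c * Ψ u) * ν {t | 1 - t ≤ u} := by
        rw [lintegral_indicator_const (measurableSet_le (by fun_prop) (by fun_prop))]
    _ ≤ ENNReal.ofReal (2 ^ s * u ^ (-s)) * (c * Ψ u) * ENNReal.ofReal (K * u ^ s) := by
        gcongr
        exact hν u hu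
    _ = ENNReal.ofReal (2 ^ s * u ^ (-s)) * ENNReal.ofReal (K * u ^ s) * c * Ψ u := by ring
    _ = _ := by
        rw [← ENNReal.ofReal_mul (by positivity)]
        congr 3
        rw [show 2 ^ s * u ^ (-s) * (K * u ^ s) = K * 2 ^ s * (u ^ (-s) * u ^ s) by ring,
          ← Real.rpow_add hu]
        simp

open Metric Real in
/-- Carleson embedding on the radius, for functions analytic across the unit circle. -/
theorem lintegral_norm_rpow_le_of_differentiableOn {ν : Measure ℝ} [SFinite ν] {K s p ρ : ℝ}
    (hK : 0 < K) (hν : ∀ u : ℝ, 0 < u → ν {t | 1 - t ≤ u} ≤ ENNReal.ofReal (K * u ^ s))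
    (hs : 1 ≤ s) (hsupp : ∀ᵐ t ∂ν, t ∈ Ico (0:ℝ) 1) (hp : 0 < p) (hρ : 1 < ρ) {F : ℂ → ℂ}
    (hF : DifferentiableOn ℂ F (ball 0 ρ)) :
    ∫⁻ t, ENNReal.ofReal (‖F (t:ℂ)‖ ^ (p * s)) ∂ν ≤ ENNReal.ofReal (128 * K * 2 ^ s) *
      (∫⁻ θ in Ioc (-π) π, ENNReal.ofReal (‖F (circleMap 0 1 θ)‖ ^ p)) ^ s := by
  set M := ∫⁻ θ in Ioc (-π) π, ENNReal.ofReal (‖F (circleMap 0 1 θ)‖ ^ p) with hM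
  have hFc : Continuous fun θ : ℝ => F (circleMap 0 1 θ) := by
    refine hF.continuousOn.comp_continuous (continuous_circleMap 0 1) fun θ => ?_
    simpa using hρ
  set φ : ℝ → ENNReal := fun θ => ENNReal.ofReal (‖F (circleMap 0 1 θ)‖ ^ (p / 2)) with hφ
  have hφm : Measurable φ := by
    refine ENNReal.measurable_ofReal.comp (Continuous.measurable ?_)
    exact hFc.norm.rpow_const fun _ => Or.inr (by positivity)
  have hφ2 : ∫⁻ θ in Ioc (-π) π, φ θ ^ 2 = M := by
    refine lintegral_congr fun θ => ?_
    rw [← ENNReal.ofReal_pow (by positivity), ← rpow_mul_natCast (norm_nonneg _)]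
    congr 2; push_cast; ring
  set H : ℝ → ENNReal := fun u => ∫⁻ θ in Ioc (-π) π, φ θ * ENNReal.ofReal (max u |θ|)⁻¹ with hH
  have hHm : Measurable H := Measurable.lintegral_prod_right' (f := fun z : ℝ × ℝ =>
    φ z.2 * ENNReal.ofReal (max z.1 |z.2|)⁻¹) (by fun_prop)
  have hHd : ∀ x u : ℝ, 0 < x → x ≤ u → u ≤ 2 * x → H x ^ 2 ≤ 4 * H u ^ 2 := by
    intro x u hx hxu hux
    have : H x ≤ 2 * H u := by
      simp only [hH]
      rw [← lintegral_const_mul' _ _ (by simp)]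
      refine lintegral_mono fun θ => ?_
      simp only
      rw [mul_left_comm]
      gcongr
      rw [show (2:ENNReal) = ENNReal.ofReal 2 by simp, ← ENNReal.ofReal_mul two_pos.le]
      refine ENNReal.ofReal_le_ofReal ?_
      have h1 : 0 < max x |θ| := lt_max_of_lt_left hx
      have h2 : 0 < max u |θ| := lt_max_of_lt_left (hx.trans_le hxu)
      rw [← div_eq_mul_inv, ← one_div, div_le_div_iff₀ h1 h2, one_mul, mul_max_of_nonneg _ _ two_pos.le]
      exact max_le_max hux (by linarith [abs_nonneg θ])
    calc H x ^ 2 ≤ (2 * H u) ^ 2 := pow_le_pow_left' this 2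
      _ = _ := by rw [mul_pow]; norm_num
  have hpt : ∀ᵐ t : ℝ ∂ν, ENNReal.ofReal (‖F (t:ℂ)‖ ^ (p * s)) ≤
      M ^ (s - 1) * (ENNReal.ofReal ((1 - t) ^ (1 - s)) * H (1 - t) ^ 2) := by
    filter_upwards [hsupp] with t ht
    have hx : 0 < 1 - t := by linarith [ht.2]
    have b1 : ENNReal.ofReal (‖F (t:ℂ)‖ ^ p) ≤ M * ENNReal.ofReal (1 - t)⁻¹ := by
      refine (ofReal_norm_rpow_le_lintegral hp hρ hF ht.1 ht.2).trans ?_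
      rw [hM, ← lintegral_mul_const' _ _ ENNReal.ofReal_ne_top]
      refine lintegral_mono fun θ => ?_
      simp only
      gcongr
      exact le_max_left _ _
    have b2 : ENNReal.ofReal (‖F (t:ℂ)‖ ^ (p / 2)) ≤ H (1 - t) :=
      ofReal_norm_rpow_le_lintegral (by positivity) hρ hF ht.1 ht.2
    have e1 : ENNReal.ofReal (‖F (t:ℂ)‖ ^ (p * s)) =
        ENNReal.ofReal (‖F (t:ℂ)‖ ^ p) ^ (s - 1) * ENNReal.ofReal (‖F (t:ℂ)‖ ^ (p / 2)) ^ 2 := by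
      rw [ENNReal.ofReal_rpow_of_nonneg (by positivity) (by linarith),
        ← ENNReal.ofReal_pow (by positivity), ← ENNReal.ofReal_mul (by positivity),
        ← rpow_mul_natCast (norm_nonneg _), ← rpow_mul (norm_nonneg _),
        ← rpow_add_of_nonneg (norm_nonneg _) (mul_nonneg hp.le (by linarith)) (by positivity)]
      congr 2; push_cast; ring
    rw [e1, ← mul_assoc]
    refine mul_le_mul' ?_ (pow_le_pow_left' b2 2)
    refine (ENNReal.rpow_le_rpow b1 (by linarith)).trans_eq ?_
    rw [ENNReal.mul_rpow_of_nonneg _ _ (by linarith),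
      ENNReal.ofReal_rpow_of_pos (by positivity), inv_rpow hx.le, ← rpow_neg hx.le]
    congr 3; ring
  refine (lintegral_mono_ae hpt).trans ?_
  rw [lintegral_const_mul _ (by fun_prop)]
  have hcmp := lintegral_rpow_mul_le_lintegral_Ioi (Ψ := fun u => H u ^ 2) hν (by linarith)
    (hsupp.mono fun t ht => ht.2) (by fun_prop) hHd
  have hschur := lintegral_sq_lintegral_inv_max_le hφm
  rw [hφ2] at hschur
  calc _ ≤ M ^ (s - 1) * (ENNReal.ofReal (K * 2 ^ s) * 4 * (ENNReal.ofReal 32 * M)) := by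
        gcongr
        exact hcmp.trans (by gcongr)
    _ = ENNReal.ofReal (K * 2 ^ s) * 4 * ENNReal.ofReal 32 * (M ^ (s - 1) * M ^ (1:ℝ)) := by
        rw [ENNReal.rpow_one]; ring
    _ = _ := by
        rw [← ENNReal.rpow_add_of_nonneg _ _ (by linarith) zero_le_one,
          show (4:ENNReal) = ENNReal.ofReal 4 by simp, ← ENNReal.ofReal_mul (by positivity),
          ← ENNReal.ofReal_mul (by positivity)]
        congr 2
        · ring
        · ring

open Metric Real in
theorem MemHp.lintegral_circle_le {p : ℝ} (hp : 0 < p) {f : ℂ → ℂ} (hf : MemHp p f) {R : ℝ}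
    (hR : 0 < R) (hR1 : R < 1) :
    ∫⁻ θ in Ioc (-π) π, ENNReal.ofReal (‖f (R * circleMap 0 1 θ)‖ ^ p) ≤
      ENNReal.ofReal (2 * π * hardyNorm p f ^ p) := by
  have hsub : ∀ z ∈ sphere (0:ℂ) 1, (R:ℂ) * z ∈ ball (0:ℂ) 1 := by
    intro z hz
    have : ‖z‖ = 1 := by simpa using hz
    simpa [this, abs_of_pos hR] using hR1
  have hc : ContinuousOn (fun z => ‖f (R * z)‖ ^ p) (sphere (0:ℂ) 1) :=
    (hf.1.continuousOn.comp (by fun_prop) hsub).norm.rpow_const fun _ _ => Or.inr hp.le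
  have e := ofReal_circleAverage_eq_lintegral hc fun z _ => by positivity
  set I := circleAverage (fun z => ‖f (R * z)‖ ^ p) 0 1 with hI
  have hI0 : 0 ≤ I := by
    rw [hI, circleAverage, smul_eq_mul]
    exact mul_nonneg (by positivity)
      (intervalIntegral.integral_nonneg (by positivity) fun _ _ => by positivity)
  have hle : I ^ (1 / p) ≤ hardyNorm p f := by
    refine le_csSup hf.2 ⟨R, hR, hR1, ?_⟩
    simp [hI, circleAverage, circleMap]
  have hle' : I ≤ hardyNorm p f ^ p := by
    have := rpow_le_rpow (by positivity) hle hp.le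
    rwa [← rpow_mul hI0, one_div_mul_cancel hp.ne', rpow_one] at this
  calc _ = ENNReal.ofReal (2 * π) * ENNReal.ofReal I := by
        rw [e, ← mul_assoc, ← ENNReal.ofReal_mul (by positivity),
          mul_inv_cancel₀ (by positivity), ENNReal.ofReal_one, one_mul]
    _ ≤ _ := by
        rw [← ENNReal.ofReal_mul (by positivity)]
        gcongr

theorem hardyNorm_nonneg {p : ℝ} (f : ℂ → ℂ) : 0 ≤ hardyNorm p f := by
  refine Real.sSup_nonneg ?_
  rintro y ⟨r, hr, hr1, rfl⟩
  refine Real.rpow_nonneg (mul_nonneg (by positivity) ?_) _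
  exact intervalIntegral.integral_nonneg (by positivity) fun _ _ => by positivity

open Metric Real Filter Topology in
/-- Carleson embedding of `H^p` on the radius. -/
theorem MemHp.lintegral_norm_rpow_le {ν : Measure ℝ} [SFinite ν] {K s p : ℝ}
    (hK : 0 < K) (hν : ∀ u : ℝ, 0 < u → ν {t | 1 - t ≤ u} ≤ ENNReal.ofReal (K * u ^ s))
    (hs : 1 ≤ s) (hsupp : ∀ᵐ t ∂ν, t ∈ Ico (0:ℝ) 1) (hp : 0 < p) {f : ℂ → ℂ} (hf : MemHp p f) :
    ∫⁻ t, ENNReal.ofReal (‖f (t:ℂ)‖ ^ (p * s)) ∂ν ≤ ENNReal.ofReal (128 * K * 2 ^ s) *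
      ENNReal.ofReal (2 * π * hardyNorm p f ^ p) ^ s := by
  have hps : 0 < p * s := by positivity
  obtain ⟨R, -, hR, hRlim⟩ := exists_seq_strictMono_tendsto' (zero_lt_one (α := ℝ))
  have hmem : ∀ n, ∀ t ∈ Ico (0:ℝ) 1, (R n : ℂ) * t ∈ ball (0:ℂ) 1 := by
    intro n t ht
    simp only [mem_ball, dist_zero_right, norm_mul, Complex.norm_real, Real.norm_eq_abs,
      abs_of_pos (hR n).1, abs_of_nonneg ht.1]
    nlinarith [(hR n).1, (hR n).2, ht.1, ht.2]
  have hn : ∀ n, ∫⁻ t, ENNReal.ofReal (‖f (R n * (t:ℂ))‖ ^ (p * s)) ∂ν ≤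
      ENNReal.ofReal (128 * K * 2 ^ s) * ENNReal.ofReal (2 * π * hardyNorm p f ^ p) ^ s := by
    intro n
    have h0 := (hR n).1
    have hd : DifferentiableOn ℂ (fun z => f (R n * z)) (ball 0 (R n)⁻¹) := by
      refine hf.1.comp (by fun_prop) fun z hz => ?_
      simp only [mem_ball, dist_zero_right, norm_mul, Complex.norm_real, Real.norm_eq_abs,
        abs_of_pos h0] at hz ⊢
      calc R n * ‖z‖ < R n * (R n)⁻¹ := by gcongr
        _ = 1 := mul_inv_cancel₀ h0.ne'
    refine (lintegral_norm_rpow_le_of_differentiableOn hK hν hs hsupp hp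
      ((one_lt_inv₀ h0).2 (hR n).2) hd).trans ?_
    gcongr
    exact hf.lintegral_circle_le hp h0 (hR n).2
  have hmeas : ∀ n, AEMeasurable (fun t : ℝ => ENNReal.ofReal (‖f (R n * (t:ℂ))‖ ^ (p * s))) ν := by
    intro n
    rw [← Measure.restrict_eq_self_of_ae_mem hsupp]
    refine ENNReal.measurable_ofReal.comp_aemeasurable
      (ContinuousOn.aemeasurable ?_ measurableSet_Ico)
    exact (hf.1.continuousOn.comp (by fun_prop) (hmem n)).norm.rpow_const fun _ _ => Or.inr hps.le
  have hlim : ∀ᵐ t : ℝ ∂ν, ENNReal.ofReal (‖f (t:ℂ)‖ ^ (p * s)) ≤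
      liminf (fun n => ENNReal.ofReal (‖f (R n * (t:ℂ))‖ ^ (p * s))) atTop := by
    filter_upwards [hsupp] with t ht
    refine le_of_eq (Tendsto.liminf_eq ?_).symm
    refine ENNReal.tendsto_ofReal (Tendsto.rpow_const ?_ (Or.inr hps.le))
    refine Tendsto.norm ?_
    have hc : ContinuousAt f (t:ℂ) := hf.1.continuousOn.continuousAt
      (isOpen_ball.mem_nhds (by simpa [abs_of_nonneg ht.1] using ht.2))
    refine hc.tendsto.comp ?_
    have h1 : Tendsto (fun n => (R n : ℂ)) atTop (𝓝 1) := by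
      simpa [Function.comp_def] using (Complex.continuous_ofReal.tendsto 1).comp hRlim
    simpa using h1.mul_const (t:ℂ)
  refine (lintegral_mono_ae hlim).trans ((lintegral_liminf_le' hmeas).trans ?_)
  exact liminf_le_of_le (by isBoundedDefault) fun b hb => by
    obtain ⟨n, hbn⟩ := hb.exists
    exact hbn.trans (hn n)

open Metric Real in
/-- Mean value inequality for `‖g‖ ^ ε` on disks. -/
theorem ofReal_norm_rpow_mul_le_lintegral_ball {g : ℂ → ℂ} {c : ℂ} {r ρ ε : ℝ} (hε : 0 < ε)
    (hρ : 0 < ρ) (hρr : ρ ≤ r) (hg : DifferentiableOn ℂ g (ball c r)) :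
    ENNReal.ofReal (‖g c‖ ^ ε) * ENNReal.ofReal (π * ρ ^ 2) ≤
      ∫⁻ z in ball c ρ, ENNReal.ofReal (‖g z‖ ^ ε) := by
  have hcirc : ∀ a ∈ Ioo 0 ρ, ENNReal.ofReal (2 * π) * ENNReal.ofReal (‖g c‖ ^ ε) ≤
      ∫⁻ θ in Ioo (-π) π, ENNReal.ofReal (‖g (c + circleMap 0 a θ)‖ ^ ε) := by
    intro a ha
    have hd : DifferentiableOn ℂ (fun z => g (c + a * z)) (ball 0 (r / a)) := by
      refine hg.comp (by fun_prop) fun z hz => ?_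
      simp only [mem_ball, dist_zero_right] at hz
      rw [lt_div_iff₀ ha.1] at hz
      simpa [abs_of_pos ha.1, mul_comm] using hz
    have h := ofReal_norm_rpow_center_le_lintegral hε
      ((one_lt_div ha.1).2 (ha.2.trans_le hρr)) hd
    rw [setLIntegral_congr (Ioo_ae_eq_Ioc (a := -π) (b := π))]
    calc _ ≤ ENNReal.ofReal (2 * π) * (ENNReal.ofReal (2 * π)⁻¹ * ∫⁻ θ in Ioc (-π) π,
          ENNReal.ofReal (‖g (c + a * circleMap 0 1 θ)‖ ^ ε)) := by
          gcongr
          simpa using h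
      _ = _ := by
          rw [← mul_assoc, ← ENNReal.ofReal_mul (by positivity),
            mul_inv_cancel₀ (by positivity), ENNReal.ofReal_one, one_mul]
          simp [circleMap]
  set h : ℂ → ENNReal := (ball c ρ).indicator fun z => ENNReal.ofReal (‖g z‖ ^ ε) with hh
  have hm : Measurable h := by
    classical
    have : ContinuousOn (fun z => ‖g z‖ ^ ε) (ball c ρ) :=
      (hg.continuousOn.mono (ball_subset_ball hρr)).norm.rpow_const fun _ _ => Or.inr hε.le
    rw [hh, ← piecewise_eq_indicator]
    exact (ENNReal.continuous_ofReal.comp_continuousOn this).measurable_piecewise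
      continuousOn_const measurableSet_ball
  rw [← lintegral_indicator measurableSet_ball, ← hh,
    ← lintegral_add_left_eq_self h c, ← Complex.lintegral_comp_polarCoord_symm]
  have htarget : polarCoord.target = Ioi (0 : ℝ) ×ˢ Ioo (-π) π := rfl
  rw [htarget, Measure.volume_eq_prod, ← Measure.prod_restrict, lintegral_prod _ (by
    refine Measurable.aemeasurable ?_
    simp only [Complex.polarCoord_symm_apply]
    fun_prop)]
  calc ENNReal.ofReal (‖g c‖ ^ ε) * ENNReal.ofReal (π * ρ ^ 2)
      = ∫⁻ a in Ioo 0 ρ, ENNReal.ofReal a *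
          (ENNReal.ofReal (2 * π) * ENNReal.ofReal (‖g c‖ ^ ε)) := by
        have : ∫⁻ a in Ioo 0 ρ, ENNReal.ofReal a = ENNReal.ofReal (ρ ^ 2 / 2) := by
          rw [setLIntegral_congr Ioo_ae_eq_Ioc, ← ofReal_integral_eq_lintegral_ofReal,
            ← intervalIntegral.integral_of_le hρ.le, integral_id]
          · simp
          · exact (intervalIntegrable_iff_integrableOn_Ioc_of_le hρ.le).1
              (continuous_id.intervalIntegrable _ _)
          · exact (ae_restrict_mem measurableSet_Ioc).mono fun u hu => hu.1.le
        rw [lintegral_mul_const _ (by fun_prop), this, ← mul_assoc,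
          ← ENNReal.ofReal_mul (p := ρ ^ 2 / 2) (by positivity), mul_comm]
        congr 2; ring
    _ ≤ ∫⁻ a in Ioo 0 ρ, ∫⁻ θ in Ioo (-π) π,
          ENNReal.ofReal a • h (c + Complex.polarCoord.symm (a, θ)) := by
        refine setLIntegral_mono' measurableSet_Ioo fun a ha => ?_
        simp only [smul_eq_mul]
        rw [lintegral_const_mul' _ _ ENNReal.ofReal_ne_top]
        gcongr
        refine (hcirc a ha).trans_eq (lintegral_congr fun θ => ?_)
        have e : Complex.polarCoord.symm (a, θ) = circleMap 0 a θ := by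
          rw [Complex.polarCoord_symm_apply, circleMap, Complex.exp_mul_I]
          simp
        rw [e, hh, indicator_of_mem]
        simpa [abs_of_pos ha.1] using ha.2
    _ ≤ _ := lintegral_mono_set Ioo_subset_Ioi_self

theorem norm_bounds_of_mem_ball {t : ℝ} (ht : 0 ≤ t) {z : ℂ}
    (hz : z ∈ Metric.ball (t:ℂ) ((1 - t) / 2)) :
    (1 - t) / 2 ≤ 1 - ‖z‖ ∧ 1 - ‖z‖ ≤ 3 / 2 * (1 - t) := by
  have h1 : ‖z - t‖ < (1 - t) / 2 := by simpa [dist_eq_norm] using hz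
  have h2 := norm_sub_norm_le z (t:ℂ)
  have h3 := norm_sub_norm_le (t:ℂ) z
  rw [norm_sub_rev] at h3
  simp only [Complex.norm_real, Real.norm_eq_abs, abs_of_nonneg ht] at h2 h3
  constructor <;> linarith

theorem min_mul_rpow_le_of_mem_ball {t : ℝ} (ht : 0 ≤ t) (ht1 : t < 1) (β : ℝ) {z : ℂ}
    (hz : z ∈ Metric.ball (t:ℂ) ((1 - t) / 2)) :
    min ((1 / 2) ^ β) (3 ^ β) * (1 - t) ^ β ≤ (1 - ‖z‖ ^ 2) ^ β := by
  obtain ⟨h1, h2⟩ := norm_bounds_of_mem_ball ht hz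
  have hx : 0 < 1 - t := by linarith
  have hz0 := norm_nonneg z
  have l1 : 1 / 2 * (1 - t) ≤ 1 - ‖z‖ ^ 2 := by nlinarith
  have l2 : 1 - ‖z‖ ^ 2 ≤ 3 * (1 - t) := by nlinarith
  have hx' : 0 < 1 - ‖z‖ ^ 2 := by linarith
  rcases le_total 0 β with hβ | hβ
  · calc _ ≤ (1 / 2) ^ β * (1 - t) ^ β := by gcongr; exact min_le_left _ _
      _ = (1 / 2 * (1 - t)) ^ β := (Real.mul_rpow (by norm_num) hx.le).symm
      _ ≤ _ := Real.rpow_le_rpow (by positivity) l1 hβ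
  · calc _ ≤ 3 ^ β * (1 - t) ^ β := by gcongr; exact min_le_right _ _
      _ = (3 * (1 - t)) ^ β := (Real.mul_rpow (by norm_num) hx.le).symm
      _ ≤ _ := Real.rpow_le_rpow_of_nonpos hx' l2 hβ

open Metric Real in
/-- Weighted mean value inequality on the disk of radius `(1 - t) / 2` about `t`. -/
theorem ofReal_norm_rpow_le_lintegral_weighted {g : ℂ → ℂ} {t q α : ℝ} (hq : 0 < q)
    (hg : DifferentiableOn ℂ g (ball 0 1)) (ht : 0 ≤ t) (ht1 : t < 1) :
    ENNReal.ofReal (‖g t‖ ^ q) ≤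
      ENNReal.ofReal (4 / (π * min ((1 / 2) ^ (α - 2)) (3 ^ (α - 2))) * (1 - t) ^ (-α)) *
      ∫⁻ z in ball (t:ℂ) ((1 - t) / 2), ENNReal.ofReal (‖g z‖ ^ q * (1 - ‖z‖ ^ 2) ^ (α - 2)) := by
  have hx : 0 < 1 - t := by linarith
  set m : ℝ := min ((1 / 2) ^ (α - 2)) (3 ^ (α - 2)) with hm
  have hm0 : 0 < m := lt_min (by positivity) (by positivity)
  have hsub : ball (t:ℂ) (1 - t) ⊆ ball 0 1 := by
    refine ball_subset_ball' ?_
    simp [abs_of_nonneg ht]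
  have h := ofReal_norm_rpow_mul_le_lintegral_ball hq (half_pos hx) (half_le_self hx.le)
    (hg.mono hsub)
  have h2 : ENNReal.ofReal (m * (1 - t) ^ (α - 2)) *
      ∫⁻ z in ball (t:ℂ) ((1 - t) / 2), ENNReal.ofReal (‖g z‖ ^ q) ≤
      ∫⁻ z in ball (t:ℂ) ((1 - t) / 2), ENNReal.ofReal (‖g z‖ ^ q * (1 - ‖z‖ ^ 2) ^ (α - 2)) := by
    rw [← lintegral_const_mul' _ _ ENNReal.ofReal_ne_top]
    refine setLIntegral_mono' measurableSet_ball fun z hz => ?_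
    rw [← ENNReal.ofReal_mul (by positivity), mul_comm]
    gcongr
    exact min_mul_rpow_le_of_mem_ball ht ht1 _ hz
  calc ENNReal.ofReal (‖g t‖ ^ q)
      = ENNReal.ofReal (4 / (π * m) * (1 - t) ^ (-α)) * (ENNReal.ofReal (m * (1 - t) ^ (α - 2)) *
          (ENNReal.ofReal (‖g t‖ ^ q) * ENNReal.ofReal (π * ((1 - t) / 2) ^ 2))) := by
        rw [← ENNReal.ofReal_mul (by positivity), ← ENNReal.ofReal_mul (by positivity),
          ← ENNReal.ofReal_mul (by positivity)]
        congr 1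
        have : (1 - t) ^ (-α) * (1 - t) ^ (α - 2) * (1 - t) ^ 2 = 1 := by
          rw [← rpow_natCast, ← rpow_add hx, ← rpow_add hx,
            show -α + (α - 2) + ((2:ℕ):ℝ) = 0 by push_cast; ring, rpow_zero]
        calc ‖g t‖ ^ q = ‖g t‖ ^ q * ((1 - t) ^ (-α) * (1 - t) ^ (α - 2) * (1 - t) ^ 2) := by
              rw [this, mul_one]
          _ = _ := by field_simp; ring
    _ ≤ _ := by
        gcongr
        exact le_trans (by gcongr) h2

open Metric Real in
/-- Carleson embedding of the weighted Bergman space on the radius. -/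
theorem lintegral_norm_rpow_le_bergman {ν : Measure ℝ} [SFinite ν] {K s q α : ℝ}
    (hK : 0 < K) (hν : ∀ u : ℝ, 0 < u → ν {t | 1 - t ≤ u} ≤ ENNReal.ofReal (K * u ^ s))
    (hα : 0 < α) (hs : α ≤ s) (hsupp : ∀ᵐ t ∂ν, t ∈ Ico (0:ℝ) 1) (hq : 0 < q) {g : ℂ → ℂ}
    (hg : DifferentiableOn ℂ g (ball 0 1)) :
    ∫⁻ t, ENNReal.ofReal (‖g (t:ℂ)‖ ^ (q * (s / α))) ∂ν ≤
      ENNReal.ofReal ((4 / (π * min ((1 / 2) ^ (α - 2)) (3 ^ (α - 2)))) ^ (s / α) * (3 ^ s * K)) *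
      (∫⁻ z in ball (0:ℂ) 1, ENNReal.ofReal (‖g z‖ ^ q * (1 - ‖z‖ ^ 2) ^ (α - 2))) ^ (s / α) := by
  set A : ℝ := 4 / (π * min ((1 / 2) ^ (α - 2)) (3 ^ (α - 2))) with hA
  have hA0 : 0 < A := by
    have : (0:ℝ) < min ((1 / 2) ^ (α - 2)) (3 ^ (α - 2)) := lt_min (by positivity) (by positivity)
    positivity
  have hsα : 1 ≤ s / α := (one_le_div hα).2 hs
  have hs0 : 0 < s := hα.trans_le hs
  set W : ℂ → ENNReal := (ball (0:ℂ) 1).indicator fun z =>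
    ENNReal.ofReal (‖g z‖ ^ q * (1 - ‖z‖ ^ 2) ^ (α - 2)) with hW
  have hWm : Measurable W := by
    classical
    have : ContinuousOn (fun z => ‖g z‖ ^ q * (1 - ‖z‖ ^ 2) ^ (α - 2)) (ball (0:ℂ) 1) := by
      refine (hg.continuousOn.norm.rpow_const fun _ _ => Or.inr hq.le).mul
        (ContinuousOn.rpow_const (by fun_prop) fun z hz => Or.inl ?_)
      have : ‖z‖ < 1 := by simpa using hz
      nlinarith [norm_nonneg z]
    rw [hW, ← piecewise_eq_indicator]
    exact (ENNReal.continuous_ofReal.comp_continuousOn this).measurable_piecewise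
      continuousOn_const measurableSet_ball
  have hN : ∫⁻ z in ball (0:ℂ) 1, ENNReal.ofReal (‖g z‖ ^ q * (1 - ‖z‖ ^ 2) ^ (α - 2)) =
      ∫⁻ z, W z := by rw [hW, lintegral_indicator measurableSet_ball]
  rw [hN]
  set N := ∫⁻ z, W z
  set S : Set (ℝ × ℂ) := {y | dist y.2 (y.1:ℂ) < (1 - y.1) / 2} with hS
  have hSm : MeasurableSet S := measurableSet_lt (by fun_prop) (by fun_prop)
  set E : ℝ → ENNReal := fun t => ∫⁻ z, S.indicator (fun y => W y.2) (t, z) with hE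
  have hEm : Measurable E := Measurable.lintegral_prod_right'
    (Measurable.indicator (hWm.comp measurable_snd) hSm)
  have hEN : ∀ t, E t ≤ N := fun t => lintegral_mono fun z => indicator_le_self' (by simp) _
  have hpt : ∀ᵐ t : ℝ ∂ν, ENNReal.ofReal (‖g (t:ℂ)‖ ^ (q * (s / α))) ≤
      ENNReal.ofReal (A ^ (s / α)) * N ^ (s / α - 1) *
        (ENNReal.ofReal ((1 - t) ^ (-s)) * E t) := by
    filter_upwards [hsupp] with t ht
    have hx : 0 < 1 - t := by linarith [ht.2]
    have hsub : ball (t:ℂ) ((1 - t) / 2) ⊆ ball 0 1 := by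
      refine ball_subset_ball' ?_
      simp only [dist_zero_right, Complex.norm_real, Real.norm_eq_abs, abs_of_nonneg ht.1]
      linarith
    have b1 : ENNReal.ofReal (‖g (t:ℂ)‖ ^ q) ≤ ENNReal.ofReal (A * (1 - t) ^ (-α)) * E t := by
      refine (ofReal_norm_rpow_le_lintegral_weighted (α := α) hq hg ht.1 ht.2).trans_eq ?_
      congr 1
      rw [← lintegral_indicator measurableSet_ball]
      refine lintegral_congr fun z => ?_
      by_cases hz : z ∈ ball (t:ℂ) ((1 - t) / 2)
      · rw [indicator_of_mem hz, indicator_of_mem (show (t, z) ∈ S from hz), hW,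
          indicator_of_mem (hsub hz)]
      · rw [indicator_of_notMem hz, indicator_of_notMem (show (t, z) ∉ S from hz)]
    have e1 : ENNReal.ofReal (‖g (t:ℂ)‖ ^ (q * (s / α))) =
        ENNReal.ofReal (‖g (t:ℂ)‖ ^ q) ^ (s / α - 1) * ENNReal.ofReal (‖g (t:ℂ)‖ ^ q) := by
      rw [ENNReal.ofReal_rpow_of_nonneg (by positivity) (by linarith),
        ← ENNReal.ofReal_mul (by positivity), ← rpow_mul (norm_nonneg _),
        ← rpow_add_of_nonneg (norm_nonneg _) (mul_nonneg hq.le (by linarith)) hq.le]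
      congr 2; ring
    have b2 := b1.trans (mul_le_mul_right (hEN t) _)
    rw [e1]
    calc _ ≤ (ENNReal.ofReal (A * (1 - t) ^ (-α)) * N) ^ (s / α - 1) *
          (ENNReal.ofReal (A * (1 - t) ^ (-α)) * E t) :=
          mul_le_mul' (ENNReal.rpow_le_rpow b2 (by linarith)) b1
      _ = ENNReal.ofReal ((A * (1 - t) ^ (-α)) ^ (s / α - 1) * (A * (1 - t) ^ (-α))) *
          N ^ (s / α - 1) * E t := by
          rw [ENNReal.mul_rpow_of_nonneg _ _ (by linarith),
            ENNReal.ofReal_rpow_of_pos (by positivity),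
            ENNReal.ofReal_mul (p := (A * (1 - t) ^ (-α)) ^ (s / α - 1)) (by positivity)]
          ring
      _ = ENNReal.ofReal (A ^ (s / α) * (1 - t) ^ (-s)) * N ^ (s / α - 1) * E t := by
          congr 3
          rw [← rpow_add_one (by positivity), sub_add_cancel, mul_rpow hA0.le (by positivity),
            ← rpow_mul hx.le]
          congr 2
          field_simp
      _ = _ := by
          rw [ENNReal.ofReal_mul (by positivity)]
          ring
  refine (lintegral_mono_ae hpt).trans ?_
  rw [lintegral_const_mul _ (by fun_prop)]
  have hmain : ∫⁻ t, ENNReal.ofReal ((1 - t) ^ (-s)) * E t ∂ν ≤ ENNReal.ofReal (3 ^ s * K) * N := by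
    have e : ∀ t, ENNReal.ofReal ((1 - t) ^ (-s)) * E t =
        ∫⁻ z, ENNReal.ofReal ((1 - t) ^ (-s)) * S.indicator (fun y => W y.2) (t, z) := fun t =>
      (lintegral_const_mul' _ _ ENNReal.ofReal_ne_top).symm
    have hm2 : Measurable (S.indicator fun y : ℝ × ℂ => W y.2) :=
      Measurable.indicator (hWm.comp measurable_snd) hSm
    simp only [e]
    rw [lintegral_lintegral_swap (f := fun t z => ENNReal.ofReal ((1 - t) ^ (-s)) *
      S.indicator (fun y => W y.2) (t, z)) (by
        refine Measurable.aemeasurable (Measurable.mul (by fun_prop) hm2)),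
      ← lintegral_const_mul _ hWm]
    refine lintegral_mono fun z => ?_
    by_cases hz : z ∈ ball (0:ℂ) 1
    · have hy : 0 < 1 - ‖z‖ := by
        have : ‖z‖ < 1 := by simpa using hz
        linarith
      set y := 1 - ‖z‖ with hy'
      have hset : MeasurableSet {t : ℝ | 1 - t ≤ 2 * y} :=
        measurableSet_le (by fun_prop) (by fun_prop)
      calc _ ≤ ∫⁻ t, {t : ℝ | 1 - t ≤ 2 * y}.indicator
            (fun _ => ENNReal.ofReal ((2 / 3 * y) ^ (-s)) * W z) t ∂ν := by
            refine lintegral_mono_ae ?_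
            filter_upwards [hsupp] with t ht
            by_cases h : (t, z) ∈ S
            · have hb : z ∈ ball (t:ℂ) ((1 - t) / 2) := h
              obtain ⟨h1, h2⟩ := norm_bounds_of_mem_ball ht.1 hb
              rw [indicator_of_mem h,
                indicator_of_mem (show t ∈ {t : ℝ | 1 - t ≤ 2 * y} from by
                  change 1 - t ≤ 2 * y; linarith)]
              gcongr ENNReal.ofReal ?_ * _
              exact rpow_le_rpow_of_nonpos (by positivity) (by linarith) (by linarith)
            · rw [indicator_of_notMem h, mul_zero]
              exact zero_le
        _ = ENNReal.ofReal ((2 / 3 * y) ^ (-s)) * W z * ν {t : ℝ | 1 - t ≤ 2 * y} :=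
            lintegral_indicator_const hset _
        _ ≤ ENNReal.ofReal ((2 / 3 * y) ^ (-s)) * W z * ENNReal.ofReal (K * (2 * y) ^ s) := by
            gcongr
            exact hν _ (by positivity)
        _ = _ := by
            rw [mul_right_comm, ← ENNReal.ofReal_mul (by positivity)]
            congr 2
            have : (2 * y) ^ s = 3 ^ s * (2 / 3 * y) ^ s := by
              rw [← mul_rpow (by norm_num) (by positivity)]
              congr 1; ring
            rw [this, rpow_neg (by positivity)]
            have h0 : (2 / 3 * y) ^ s ≠ 0 := by positivity
            field_simp
    · have : W z = 0 := indicator_of_notMem hz _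
      have h0 : ∀ t : ℝ, S.indicator (fun y => W y.2) (t, z) = 0 := fun t => by
        by_cases h : (t, z) ∈ S
        · rw [indicator_of_mem h, this]
        · rw [indicator_of_notMem h]
      simp [h0]
  calc _ ≤ ENNReal.ofReal (A ^ (s / α)) * N ^ (s / α - 1) * (ENNReal.ofReal (3 ^ s * K) * N) := by
        gcongr
    _ = ENNReal.ofReal (A ^ (s / α)) * ENNReal.ofReal (3 ^ s * K) *
        (N ^ (s / α - 1) * N ^ (1:ℝ)) := by rw [ENNReal.rpow_one]; ring
    _ = _ := by
        rw [← ENNReal.rpow_add_of_nonneg _ _ (by linarith) zero_le_one,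
          ← ENNReal.ofReal_mul (by positivity), sub_add_cancel]

open Metric Real in
theorem MemBergman.lintegral_eq {q α : ℝ} (hq : 0 < q) (hα : 1 < α) {g : ℂ → ℂ}
    (hg : MemBergman q (α - 2) g) :
    ∫⁻ z in ball (0:ℂ) 1, ENNReal.ofReal (‖g z‖ ^ q * (1 - ‖z‖ ^ 2) ^ (α - 2)) =
      ENNReal.ofReal (π / (α - 1) * bergmanNorm q (α - 2) g ^ q) := by
  have hnn : ∀ z ∈ ball (0:ℂ) 1, 0 ≤ ‖g z‖ ^ q * (1 - ‖z‖ ^ 2) ^ (α - 2) := by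
    intro z hz
    have hz' : ‖z‖ < 1 := by simpa using hz
    have : 0 ≤ 1 - ‖z‖ ^ 2 := by nlinarith [norm_nonneg z]
    positivity
  rw [← ofReal_integral_eq_lintegral_ofReal hg.2
    ((ae_restrict_mem measurableSet_ball).mono hnn), bergmanNorm]
  have hI : 0 ≤ ∫ z in ball (0:ℂ) 1, ‖g z‖ ^ q * (1 - ‖z‖ ^ 2) ^ (α - 2) :=
    setIntegral_nonneg measurableSet_ball hnn
  have hα' : 0 < α - 1 := by linarith
  congr 1
  rw [show α - 2 + 1 = α - 1 by ring, ← rpow_mul (by positivity), one_div_mul_cancel hq.ne',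
    rpow_one]
  field_simp

theorem bergmanNorm_nonneg {q α : ℝ} (hα : 1 < α) (g : ℂ → ℂ) : 0 ≤ bergmanNorm q (α - 2) g := by
  refine Real.rpow_nonneg (mul_nonneg (by linarith) (mul_nonneg (by positivity) ?_)) _
  refine setIntegral_nonneg measurableSet_ball fun z hz => ?_
  have hz' : ‖z‖ < 1 := by simpa using hz
  have : 0 ≤ 1 - ‖z‖ ^ 2 := by nlinarith [norm_nonneg z]
  positivity

theorem ENNReal.ofReal_mul_ofReal_rpow_rpow {a b x r k : ℝ} (ha : 0 ≤ a) (hb : 0 ≤ b) (hx : 0 ≤ x)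
    (hr : 0 < r) (hk : 0 < k) :
    (ENNReal.ofReal a * ENNReal.ofReal (b * x ^ r) ^ k) ^ (1 / (r * k)) =
      ENNReal.ofReal (a ^ (1 / (r * k)) * b ^ (1 / r) * x) := by
  rw [ENNReal.ofReal_rpow_of_nonneg (by positivity) hk.le, ← ENNReal.ofReal_mul ha,
    ENNReal.ofReal_rpow_of_nonneg (by positivity) (by positivity)]
  congr 1
  rw [Real.mul_rpow ha (by positivity), ← Real.rpow_mul (by positivity),
    show k * (1 / (r * k)) = 1 / r by field_simp, Real.mul_rpow hb (by positivity),
    ← Real.rpow_mul hx, mul_one_div_cancel hr.ne', Real.rpow_one, mul_assoc]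

theorem stmt18 (p q α : ℝ) (hp : 0 < p) (hα : 1 < α) (hq : 1 < q) (hqa : α * p ≤ q)
    (μ : Measure ℝ) (hμsupp : μ (Ico (0:ℝ) 1)ᶜ = 0)
    (hcar : IsCarleson μ (1 / p + α / (q / (q - 1)))) :
    ∃ C : ℝ, 0 < C ∧ ∀ f g : ℂ → ℂ, MemHp p f → MemBergman (q / (q - 1)) (α - 2) g →
      ∫⁻ t in Ico (0:ℝ) 1, ENNReal.ofReal (‖f (t : ℂ)‖ * ‖g (t : ℂ)‖) ∂μ ≤
        ENNReal.ofReal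
          (C * hardyNorm p f * bergmanNorm (q / (q - 1)) (α - 2) g) := by
  have hq1 : 0 < q - 1 := by linarith
  have hα0 : 0 < α := by linarith
  have hq0 : 0 < q := by linarith
  have hsα : α ≤ 1 / p + α / (q / (q - 1)) := by
    have h1 : α / q ≤ 1 / p := by
      rw [div_le_div_iff₀ hq0 hp]
      linarith
    have h2 : α / (q / (q - 1)) = α - α / q := by
      field_simp
    linarith
  set q' := q / (q - 1)
  have hq' : 0 < q' := by positivity
  set s := 1 / p + α / q' with hs
  have hs0 : 0 < s := by linarith
  obtain ⟨K, hK, hν⟩ := hcar.exists_forall_measure_le hs0.le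
  have := hcar.isFiniteMeasure
  set ν := μ.restrict (Ico 0 1)
  have hsupp : ∀ᵐ t ∂ν, t ∈ Ico (0:ℝ) 1 := ae_restrict_mem measurableSet_Ico
  have hPQ : (p * s).HolderConjugate (q' * (s / α)) := by
    rw [Real.holderConjugate_iff]
    constructor
    · have : p * s = 1 + p * (α / q') := by rw [hs]; field_simp
      rw [this]
      have : 0 < p * (α / q') := by positivity
      linarith
    · have : (p * s)⁻¹ + (q' * (s / α))⁻¹ = (1 / p + α / q') / s := by field_simp
      rw [this, ← hs, div_self hs0.ne']
  have hA0 : 0 < 4 / (Real.pi * min ((1 / 2 : ℝ) ^ (α - 2)) (3 ^ (α - 2))) := by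
    have : (0:ℝ) < min ((1 / 2) ^ (α - 2)) (3 ^ (α - 2)) := lt_min (by positivity) (by positivity)
    positivity
  set a : ℝ := 128 * K * 2 ^ s
  set b : ℝ := (4 / (Real.pi * min ((1 / 2 : ℝ) ^ (α - 2)) (3 ^ (α - 2)))) ^ (s / α) * (3 ^ s * K)
  have ha : 0 < a := by positivity
  have hb : 0 < b := by positivity
  have hα1 : 0 < α - 1 := by linarith
  refine ⟨a ^ (1 / (p * s)) * (2 * Real.pi) ^ (1 / p) *
    (b ^ (1 / (q' * (s / α))) * (Real.pi / (α - 1)) ^ (1 / q')), by positivity,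
    fun f g hf hg => ?_⟩
  have hmem : ∀ t ∈ Ico (0:ℝ) 1, (t:ℂ) ∈ Metric.ball (0:ℂ) 1 := fun t ht => by
    simpa [abs_of_nonneg ht.1] using ht.2
  have hmeas : ∀ h : ℂ → ℂ, DifferentiableOn ℂ h (Metric.ball 0 1) →
      AEMeasurable (fun t : ℝ => ENNReal.ofReal ‖h (t:ℂ)‖) ν := fun h hh =>
    ENNReal.measurable_ofReal.comp_aemeasurable (ContinuousOn.aemeasurable
      (hh.continuousOn.comp (by fun_prop) hmem).norm measurableSet_Ico)
  have hH := hf.lintegral_norm_rpow_le hK hν (by linarith) hsupp hp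
  have hB := lintegral_norm_rpow_le_bergman hK hν hα0 hsα hsupp hq' hg.1
  rw [hg.lintegral_eq hq' hα] at hB
  have hP0 : 0 < p * s := by positivity
  have hQ0 : 0 < q' * (s / α) := by positivity
  calc ∫⁻ t, ENNReal.ofReal (‖f (t : ℂ)‖ * ‖g (t : ℂ)‖) ∂ν
      = ∫⁻ t, ENNReal.ofReal ‖f (t : ℂ)‖ * ENNReal.ofReal ‖g (t : ℂ)‖ ∂ν :=
        lintegral_congr fun t => ENNReal.ofReal_mul (norm_nonneg _)
    _ ≤ (∫⁻ t, ENNReal.ofReal ‖f (t : ℂ)‖ ^ (p * s) ∂ν) ^ (1 / (p * s)) *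
        (∫⁻ t, ENNReal.ofReal ‖g (t : ℂ)‖ ^ (q' * (s / α)) ∂ν) ^ (1 / (q' * (s / α))) :=
        ENNReal.lintegral_mul_le_Lp_mul_Lq ν hPQ (hmeas f hf.1) (hmeas g hg.1)
    _ ≤ ENNReal.ofReal (a ^ (1 / (p * s)) * (2 * Real.pi) ^ (1 / p) * hardyNorm p f) *
        ENNReal.ofReal (b ^ (1 / (q' * (s / α))) * (Real.pi / (α - 1)) ^ (1 / q') *
          bergmanNorm q' (α - 2) g) := by
        rw [← ENNReal.ofReal_mul_ofReal_rpow_rpow ha.le (by positivity) (hardyNorm_nonneg f) hp hs0,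
          ← ENNReal.ofReal_mul_ofReal_rpow_rpow hb.le (by positivity) (bergmanNorm_nonneg hα g) hq'
            (by positivity)]
        simp only [ENNReal.ofReal_rpow_of_nonneg (norm_nonneg _) hP0.le,
          ENNReal.ofReal_rpow_of_nonneg (norm_nonneg _) hQ0.le]
        gcongr
    _ = _ := by
        have h1 := hardyNorm_nonneg (p := p) f
        rw [← ENNReal.ofReal_mul (by positivity)]
        congr 1
        ring
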